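/- arXiv:2010.08870 — 4 statements merged into one kernel-verified Lean document; each statement's English description precedes it below -/
import Mathlib

section
/- Strong consistency of the maximum-likelihood estimator for the BAR model with positive correlations: let θ0 = (A, b, ρ_w) ∈ Θ and let μ be any initial distribution on {0,1}^p. Then for any sequence of maximum-likelihood estimators θ̂_T (i.e., for each T and each trajectory, θ̂_T is a maximizer over Θ of θ ↦ ∑_{k=0}^{T−1} log p_{X(k)X(k+1)}(θ)), one has θ̂_T → θ0 almost surely under P_{θ0,μ} as T → ∞. -/
open MeasureTheory Filter Matrix

/-- The state space `{0,1}^p` of the BAR model, encoded as Boolean vectors. -/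
abbrev State (p : ℕ) := Fin p → Bool

/-- The real vector in `{0,1}^p ⊆ ℝ^p` corresponding to a state. -/
noncomputable def stR {p : ℕ} (u : State p) : Fin p → ℝ := fun i => if u i then 1 else 0

/-- A parameter tuple `θ = (A, b, ρ_w)` of the BAR model with positive correlations. -/
abbrev Param (p : ℕ) := Matrix (Fin p) (Fin p) ℝ × (Fin p → ℝ) × (Fin p → ℝ)

/-- The parameter space `Θ` of the BAR model with positive correlations. -/
def barSpace (p : ℕ) (bmin ρmin ρmax : ℝ) : Set (Param p) :=
  {θ | (∀ i j, 0 ≤ θ.1 i j) ∧ (∀ i, (∑ j, θ.1 i j) + θ.2.1 i = 1) ∧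
       (∀ i, bmin ≤ θ.2.1 i) ∧ (∀ i, θ.2.2 i ∈ Set.Icc ρmin ρmax)}

/-- The Bernoulli parameter `a_i^⊤ u + b_i ρ_{w_i}` of node `i` given previous state `u`. -/
noncomputable def bern {p : ℕ} (θ : Param p) (u : State p) (i : Fin p) : ℝ :=
  (∑ j, θ.1 i j * stR u j) + θ.2.1 i * θ.2.2 i

/-- The BAR transition probability `p_{uv}(θ)`. -/
noncomputable def barTrans {p : ℕ} (θ : Param p) (u v : State p) : ℝ :=
  ∏ i, if v i then bern θ u i else 1 - bern θ u i

/-- The log-likelihood `∑_{k=0}^{T-1} log p_{X(k)X(k+1)}(θ)` of a trajectory prefix. -/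
noncomputable def logLik {p : ℕ} (θ : Param p) (T : ℕ) (ω : ℕ → State p) : ℝ :=
  ∑ k ∈ Finset.range T, Real.log (barTrans θ (ω k) (ω (k + 1)))

/-- `P` is the law of the BAR Markov chain with parameter `θ0` and initial distribution `μ`:
its finite-dimensional cylinder probabilities are the Markovian ones. -/
def IsBARLaw {p : ℕ} (θ0 : Param p) (μ : State p → ℝ)
    (P : Measure (ℕ → State p)) : Prop :=
  ∀ (n : ℕ) (x : ℕ → State p),
    P {ω | ∀ k ≤ n, ω k = x k} =
      ENNReal.ofReal (μ (x 0) * ∏ k ∈ Finset.range n, barTrans θ0 (x k) (x (k + 1)))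

section Paths

variable {S : Type*} [Fintype S]

/-- If `Q` is a nonnegative kernel with `Q h ≤ l h`, the `Q`-weight of all paths of length `n`,
with terminal reward `h`, is at most `l ^ n` times its initial value. -/
lemma sum_paths_le {Q : S → S → ℝ} {h a : S → ℝ} {l : ℝ} (hQ : ∀ u v, 0 ≤ Q u v)
    (ha : ∀ u, 0 ≤ a u) (hl : 0 ≤ l) (hh : ∀ u, ∑ v, Q u v * h v ≤ l * h u) (n : ℕ) :
    ∑ x : Fin (n + 1) → S, a (x 0) * (∏ k : Fin n, Q (x k.castSucc) (x k.succ)) * h (x (Fin.last n))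
      ≤ l ^ n * ∑ u, a u * h u := by
  induction n with
  | zero =>
    rw [← (Equiv.funUnique (Fin 1) S).symm.sum_comp]
    simp
  | succ n ih =>
    rw [← (Fin.snocEquiv fun _ : Fin (n + 2) => S).sum_comp, Fintype.sum_prod_type_right]
    have key : ∀ x : Fin (n + 1) → S, ∑ v : S,
        a ((Fin.snocEquiv fun _ : Fin (n + 2) => S) (v, x) 0) *
          (∏ k : Fin (n + 1), Q ((Fin.snocEquiv fun _ : Fin (n + 2) => S) (v, x) k.castSucc)
            ((Fin.snocEquiv fun _ : Fin (n + 2) => S) (v, x) k.succ)) *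
          h ((Fin.snocEquiv fun _ : Fin (n + 2) => S) (v, x) (Fin.last (n + 1)))
        ≤ l * (a (x 0) * (∏ k : Fin n, Q (x k.castSucc) (x k.succ)) * h (x (Fin.last n))) := by
      intro x
      have e : ∀ v : S, a ((Fin.snocEquiv fun _ : Fin (n + 2) => S) (v, x) 0) *
          (∏ k : Fin (n + 1), Q ((Fin.snocEquiv fun _ : Fin (n + 2) => S) (v, x) k.castSucc)
            ((Fin.snocEquiv fun _ : Fin (n + 2) => S) (v, x) k.succ)) *
          h ((Fin.snocEquiv fun _ : Fin (n + 2) => S) (v, x) (Fin.last (n + 1)))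
          = a (x 0) * (∏ k : Fin n, Q (x k.castSucc) (x k.succ)) *
            (Q (x (Fin.last n)) v * h v) := by
        intro v
        have h0 : (Fin.snoc (α := fun _ => S) x v : Fin (n + 2) → S) 0 = x 0 :=
          Fin.snoc_castSucc (α := fun _ => S) v x 0
        rw [Fin.prod_univ_castSucc]
        simp only [Fin.snocEquiv_apply, h0, Fin.snoc_castSucc, Fin.snoc_last, Fin.succ_last,
          ← Fin.castSucc_succ]
        ring
      simp_rw [e]
      rw [← Finset.mul_sum]
      have hw : 0 ≤ a (x 0) * ∏ k : Fin n, Q (x k.castSucc) (x k.succ) :=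
        mul_nonneg (ha _) (Finset.prod_nonneg fun _ _ => hQ _ _)
      calc _ ≤ a (x 0) * (∏ k : Fin n, Q (x k.castSucc) (x k.succ)) *
            (l * h (x (Fin.last n))) := mul_le_mul_of_nonneg_left (hh _) hw
        _ = _ := by ring
    calc _ ≤ ∑ x : Fin (n + 1) → S,
          l * (a (x 0) * (∏ k : Fin n, Q (x k.castSucc) (x k.succ)) * h (x (Fin.last n))) :=
          Finset.sum_le_sum fun x _ => key x
      _ ≤ l * (l ^ n * ∑ u, a u * h u) := by
          rw [← Finset.mul_sum]
          exact mul_le_mul_of_nonneg_left ih hl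
      _ = _ := by ring

/-- The Hellinger affinity kernel `√(p q)` of two distinct positive transition kernels `p`, `q`
contracts some function `h ≥ 1` by a factor smaller than `1`. -/
lemma exists_hellinger_contraction {p q : S → S → ℝ} (hp : ∀ u v, 0 < p u v)
    (hq : ∀ u v, 0 < q u v) (hp1 : ∀ u, ∑ v, p u v = 1) (hq1 : ∀ u, ∑ v, q u v = 1)
    (hne : p ≠ q) :
    ∃ l : ℝ, 0 < l ∧ l < 1 ∧ ∃ h : S → ℝ, (∀ u, 1 ≤ h u) ∧
      ∀ u, ∑ v, √(p u v * q u v) * h v ≤ l ^ 2 * h u := by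
  set R : S → S → ℝ := fun u v => √(p u v * q u v) with hR
  have hRpos : ∀ u v, 0 < R u v := fun u v => Real.sqrt_pos.2 (mul_pos (hp u v) (hq u v))
  have amgm : ∀ u v, R u v ≤ (p u v + q u v) / 2 := fun u v => by
    refine Real.sqrt_le_iff.2 ⟨by linarith [hp u v, hq u v], ?_⟩
    nlinarith [sq_nonneg (p u v - q u v)]
  have half : ∀ u, ∑ v, (p u v + q u v) / 2 = 1 := fun u => by
    rw [← Finset.sum_div, Finset.sum_add_distrib, hp1, hq1]; norm_num
  have row : ∀ u, ∑ v, R u v ≤ 1 := fun u =>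
    (Finset.sum_le_sum fun v _ => amgm u v).trans_eq (half u)
  obtain ⟨w, z, hwz⟩ : ∃ w z, p w z ≠ q w z := by
    by_contra! hc
    exact hne (funext fun u => funext fun v => hc u v)
  have roww : ∑ v, R w v < 1 := by
    rw [← half w]
    refine Finset.sum_lt_sum (fun v _ => amgm w v) ⟨z, Finset.mem_univ _, ?_⟩
    refine (Real.sqrt_lt' (by linarith [hp w z, hq w z])).2 ?_
    have : 0 < (p w z - q w z) ^ 2 := by
      have := sub_ne_zero.2 hwz
      positivity
    nlinarith
  set h : S → ℝ := fun u => 1 + ∑ v, R u v with hh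
  have h1 : ∀ u, 1 ≤ h u := fun u => by
    have : 0 ≤ ∑ v, R u v := Finset.sum_nonneg fun v _ => (hRpos u v).le
    simp only [hh]; linarith
  have strict : ∀ u, ∑ v, R u v * h v < h u := fun u => by
    have : ∑ v, R u v * ∑ v', R v v' < ∑ v, R u v := by
      refine Finset.sum_lt_sum (fun v _ => ?_) ⟨w, Finset.mem_univ _, ?_⟩
      · exact mul_le_of_le_one_right (hRpos u v).le (row v)
      · exact mul_lt_of_lt_one_right (hRpos u w) roww
    simp only [hh, mul_add, mul_one, Finset.sum_add_distrib]
    linarith [row u]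
  have ev : ∀ᶠ l : ℝ in nhdsWithin 1 (Set.Iio 1), ∀ u, ∑ v, R u v * h v < l ^ 2 * h u := by
    refine eventually_all.2 fun u => ?_
    have : Tendsto (fun l : ℝ => l ^ 2 * h u) (nhds 1) (nhds (1 ^ 2 * h u)) :=
      Continuous.tendsto (by fun_prop) 1
    exact (this.mono_left nhdsWithin_le_nhds).eventually_const_lt (by simpa using strict u)
  obtain ⟨l, ⟨hl, hl1⟩, hl0⟩ := ((ev.and self_mem_nhdsWithin).and
    (nhdsWithin_le_nhds (lt_mem_nhds (zero_lt_one (α := ℝ))))).exists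
  exact ⟨l, hl0, hl1, h, h1, fun u => (hl u).le⟩

end Paths

section Model

variable {p : ℕ} {bmin ρmin ρmax : ℝ}

lemma bern_mem_Ioo (hbmin : 0 < bmin) (hρmin : 0 < ρmin) (hρmax : ρmax < 1) {θ : Param p}
    (hθ : θ ∈ barSpace p bmin ρmin ρmax) (u : State p) (i : Fin p) :
    bern θ u i ∈ Set.Ioo (0 : ℝ) 1 := by
  obtain ⟨hA, hs, hb, hr⟩ := hθ
  have hst : ∀ j, 0 ≤ stR u j ∧ stR u j ≤ 1 := fun j => by
    unfold stR; split_ifs <;> norm_num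
  have h0 : 0 ≤ ∑ j, θ.1 i j * stR u j :=
    Finset.sum_nonneg fun j _ => mul_nonneg (hA i j) (hst j).1
  have h1 : ∑ j, θ.1 i j * stR u j ≤ ∑ j, θ.1 i j :=
    Finset.sum_le_sum fun j _ => mul_le_of_le_one_right (hA i j) (hst j).2
  have hbi : 0 < θ.2.1 i := hbmin.trans_le (hb i)
  have hri := hr i
  have hc0 : 0 < θ.2.1 i * θ.2.2 i := mul_pos hbi (hρmin.trans_le hri.1)
  have hc1 : θ.2.1 i * θ.2.2 i < θ.2.1 i :=
    mul_lt_of_lt_one_right hbi (hri.2.trans_lt hρmax)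
  have := hs i
  unfold bern
  constructor <;> linarith

lemma barTrans_pos (hbmin : 0 < bmin) (hρmin : 0 < ρmin) (hρmax : ρmax < 1) {θ : Param p}
    (hθ : θ ∈ barSpace p bmin ρmin ρmax) (u v : State p) : 0 < barTrans θ u v := by
  refine Finset.prod_pos fun i _ => ?_
  have := bern_mem_Ioo hbmin hρmin hρmax hθ u i
  split_ifs
  · exact this.1
  · exact sub_pos.2 this.2

lemma sum_prod_bool (f : Fin p → Bool → ℝ) :
    ∑ v : Fin p → Bool, ∏ i, f i (v i) = ∏ i, (f i true + f i false) := by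
  have := Finset.prod_univ_sum (fun _ : Fin p => (Finset.univ : Finset Bool)) f
  rw [Fintype.piFinset_univ] at this
  simpa using this.symm

lemma sum_barTrans (θ : Param p) (u : State p) : ∑ v, barTrans θ u v = 1 := by
  have := sum_prod_bool fun i b => if b = true then bern θ u i else 1 - bern θ u i
  simpa [barTrans] using this

lemma sum_barTrans_coord (θ : Param p) (u : State p) (i : Fin p) :
    ∑ v : State p, (if v i then barTrans θ u v else 0) = bern θ u i := by
  have := sum_prod_bool fun j b => if b = true then bern θ u j else
    if j = i then 0 else 1 - bern θ u j
  have hL : ∀ v : State p, (∏ j, if v j = true then bern θ u j else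
      if j = i then 0 else 1 - bern θ u j) = if v i then barTrans θ u v else 0 := by
    intro v
    split_ifs with hv
    · refine Finset.prod_congr rfl fun j _ => ?_
      by_cases hj : j = i
      · subst hj; simp [hv]
      · simp [hj]
    · exact Finset.prod_eq_zero (Finset.mem_univ i) (by simp [hv])
  simp only [hL] at this
  rw [this, Finset.prod_eq_single i]
  · simp
  · intro j _ hj; simp [hj]
  · simp

/-- The transition kernel determines the parameter. -/
lemma barTrans_injOn (hbmin : 0 < bmin) :
    Set.InjOn (barTrans (p := p)) (barSpace p bmin ρmin ρmax) := by
  intro θ hθ θ' hθ' h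
  have hbern : ∀ u i, bern θ u i = bern θ' u i := fun u i => by
    rw [← sum_barTrans_coord, ← sum_barTrans_coord, h]
  have hc : ∀ i, θ.2.1 i * θ.2.2 i = θ'.2.1 i * θ'.2.2 i := fun i => by
    simpa [bern, stR] using hbern (fun _ => false) i
  have hA : ∀ i j, θ.1 i j = θ'.1 i j := fun i j => by
    simpa [bern, stR, hc] using hbern (fun k => decide (k = j)) i
  have hb : ∀ i, θ.2.1 i = θ'.2.1 i := fun i => by
    have h1 := hθ.2.1 i
    have h2 := hθ'.2.1 i
    simp only [hA] at h1
    linarith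
  have hr : ∀ i, θ.2.2 i = θ'.2.2 i := fun i => by
    have h1 := hc i
    rw [hb i] at h1
    exact mul_left_cancel₀ (hbmin.trans_le (hθ'.2.2.1 i)).ne' h1
  exact Prod.ext (Matrix.ext hA) (Prod.ext (funext hb) (funext hr))

lemma continuous_barTrans (u v : State p) : Continuous fun θ : Param p => barTrans θ u v := by
  have hb : ∀ i, Continuous fun θ : Param p => bern θ u i := fun i => by
    unfold bern
    have : ∀ j, Continuous fun θ : Param p => θ.1 i j := fun j =>
      continuous_fst.matrix_elem i j
    fun_prop
  refine continuous_finsetProd _ fun i _ => ?_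
  split_ifs
  · exact hb i
  · exact continuous_const.sub (hb i)

lemma isCompact_barSpace (hbmin : 0 < bmin) : IsCompact (barSpace p bmin ρmin ρmax) := by
  have hK : IsCompact ((Set.univ.pi fun _ : Fin p => Set.univ.pi fun _ : Fin p =>
      Set.Icc (0 : ℝ) 1) ×ˢ ((Set.univ.pi fun _ : Fin p => Set.Icc bmin 1) ×ˢ
      (Set.univ.pi fun _ : Fin p => Set.Icc ρmin ρmax)) : Set (Param p)) :=
    (isCompact_univ_pi fun _ => isCompact_univ_pi fun _ => isCompact_Icc).prod
      ((isCompact_univ_pi fun _ => isCompact_Icc).prod (isCompact_univ_pi fun _ => isCompact_Icc))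
  refine hK.of_isClosed_subset ?_ ?_
  · have hA : ∀ i j, Continuous fun θ : Param p => θ.1 i j := fun i j =>
      continuous_fst.matrix_elem i j
    have hb : ∀ i, Continuous fun θ : Param p => θ.2.1 i := fun i => by fun_prop
    have hr : ∀ i, Continuous fun θ : Param p => θ.2.2 i := fun i => by fun_prop
    simp only [barSpace, Set.ofPred_and, Set.ofPred_forall]
    refine (isClosed_iInter fun i => isClosed_iInter fun j =>
      isClosed_le continuous_const (hA i j)).inter ((isClosed_iInter fun i =>
      isClosed_eq ((continuous_finsetSum _ fun j _ => hA i j).add (hb i))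
        continuous_const).inter ((isClosed_iInter fun i =>
      isClosed_le continuous_const (hb i)).inter (isClosed_iInter fun i =>
      isClosed_Icc.preimage (hr i))))
  · rintro θ ⟨hA, hs, hb, hr⟩
    have hsum : ∀ i j, θ.1 i j ≤ ∑ j, θ.1 i j := fun i j =>
      Finset.single_le_sum (fun j _ => hA i j) (Finset.mem_univ j)
    have hnn : ∀ i, 0 ≤ ∑ j, θ.1 i j := fun i => Finset.sum_nonneg fun j _ => hA i j
    refine ⟨fun i _ j _ => ⟨hA i j, ?_⟩, fun i _ => ⟨hb i, ?_⟩, fun i _ => hr i⟩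
    · linarith [hsum i j, hs i, hb i]
    · linarith [hnn i, hs i]

/-- Markov-type bound for the event that a multiplicative functional of the chain exceeds `1`. -/
lemma measure_one_le_prod_le {θ0 : Param p} {μ : State p → ℝ} {P : Measure (ℕ → State p)}
    (hμ0 : ∀ u, 0 ≤ μ u) (hPlaw : IsBARLaw θ0 μ P) (hpos : ∀ u v, 0 < barTrans θ0 u v)
    {r : State p → State p → ℝ} (hr : ∀ u v, 0 ≤ r u v) {h : State p → ℝ} (h1 : ∀ u, 1 ≤ h u)
    {l : ℝ} (hl : 0 ≤ l) (hh : ∀ u, ∑ v, barTrans θ0 u v * r u v * h v ≤ l * h u) (n : ℕ) :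
    P {ω | 1 ≤ ∏ k ∈ Finset.range n, r (ω k) (ω (k + 1))} ≤
      ENNReal.ofReal (l ^ n * ∑ u, μ u * h u) := by
  classical
  let ext : (Fin (n + 1) → State p) → ℕ → State p := fun x k => x (Fin.ofNat (n + 1) k)
  have ext_lt : ∀ x (k : Fin n), ext x k = x k.castSucc ∧ ext x (k + 1) = x k.succ := by
    refine fun x k => ⟨congrArg x (Fin.ext ?_), congrArg x (Fin.ext ?_)⟩
    · simp [Fin.ofNat]
    · simp [Fin.ofNat]
  set w : (Fin (n + 1) → State p) → ℝ := fun x =>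
    μ (x 0) * ∏ k : Fin n, barTrans θ0 (x k.castSucc) (x k.succ) with hw
  set g : (Fin (n + 1) → State p) → ℝ := fun x => ∏ k : Fin n, r (x k.castSucc) (x k.succ) with hg
  let bad : Finset (Fin (n + 1) → State p) := {x | 1 ≤ g x}
  have hw0 : ∀ x, 0 ≤ w x := fun x =>
    mul_nonneg (hμ0 _) (Finset.prod_nonneg fun _ _ => (hpos _ _).le)
  have cyl : ∀ x, P {ω | ∀ k ≤ n, ω k = ext x k} = ENNReal.ofReal (w x) := fun x => by
    rw [hPlaw n (ext x), Finset.prod_range]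
    simp only [ext_lt, hw]
    rfl
  have sub : {ω : ℕ → State p | 1 ≤ ∏ k ∈ Finset.range n, r (ω k) (ω (k + 1))} ⊆
      ⋃ x ∈ bad, {ω | ∀ k ≤ n, ω k = ext x k} := by
    intro ω hω
    simp only [Set.mem_iUnion]
    refine ⟨fun k => ω k, ?_, fun k hk => ?_⟩
    · simpa [bad, hg, Finset.prod_range] using hω
    · simp [ext, Fin.ofNat, Nat.mod_eq_of_lt (Nat.lt_succ_of_le hk)]
  calc _ ≤ ∑ x ∈ bad, P {ω | ∀ k ≤ n, ω k = ext x k} :=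
        (measure_mono sub).trans (measure_biUnion_finset_le _ _)
    _ = ENNReal.ofReal (∑ x ∈ bad, w x) := by
        simp only [cyl]
        rw [ENNReal.ofReal_sum_of_nonneg fun x _ => hw0 x]
    _ ≤ _ := by
        refine ENNReal.ofReal_le_ofReal ?_
        refine le_trans ?_ (sum_paths_le (fun u v => mul_nonneg (hpos u v).le (hr u v))
          hμ0 hl hh n)
        refine le_trans ?_ (Finset.sum_le_sum_of_subset_of_nonneg (Finset.subset_univ bad) ?_)
        · refine Finset.sum_le_sum fun x hx => ?_
          rw [Finset.prod_mul_distrib, ← mul_assoc, mul_assoc]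
          refine le_mul_of_one_le_right (hw0 x) ?_
          exact one_le_mul_of_one_le_of_one_le (Finset.mem_filter.1 hx).2 (h1 _)
        · intro x _ _
          exact mul_nonneg (mul_nonneg (hμ0 _) (Finset.prod_nonneg fun _ _ =>
            mul_nonneg (hpos _ _).le (hr _ _))) (zero_le_one.trans (h1 _))

lemma logLik_eq_log_prod {θ : Param p} (hpos : ∀ u v, 0 < barTrans θ u v) (T : ℕ)
    (ω : ℕ → State p) :
    logLik θ T ω = Real.log (∏ k ∈ Finset.range T, barTrans θ (ω k) (ω (k + 1))) :=
  (Real.log_prod fun _ _ => (hpos _ _).ne').symm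

/-- Every parameter other than the true one has a neighbourhood on which, almost surely, the
likelihood is eventually uniformly smaller than at the true parameter. -/
lemma exists_nhds_logLik_lt (hbmin : 0 < bmin) (hρmin : 0 < ρmin) (hρmax : ρmax < 1)
    {θ0 : Param p} (hθ0 : θ0 ∈ barSpace p bmin ρmin ρmax) {μ : State p → ℝ}
    (hμ0 : ∀ u, 0 ≤ μ u) {P : Measure (ℕ → State p)} (hPlaw : IsBARLaw θ0 μ P)
    {θ : Param p} (hθ : θ ∈ barSpace p bmin ρmin ρmax) (hne : θ ≠ θ0) :
    ∃ U ∈ nhds θ, ∀ᵐ ω ∂P, ∀ᶠ T in atTop, ∀ θ' ∈ U ∩ barSpace p bmin ρmin ρmax,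
      logLik θ' T ω < logLik θ0 T ω := by
  have pos0 := barTrans_pos hbmin hρmin hρmax hθ0
  have pos := barTrans_pos hbmin hρmin hρmax hθ
  obtain ⟨l, hl0, hl1, h, h1, hh⟩ := exists_hellinger_contraction pos pos0 (sum_barTrans θ)
    (sum_barTrans θ0) fun he => hne (barTrans_injOn hbmin hθ hθ0 he)
  set r : State p → State p → ℝ := fun u v => √(barTrans θ u v / barTrans θ0 u v) / l with hr
  have r0 : ∀ u v, 0 ≤ r u v := fun u v => by positivity
  have rsq : ∀ u v, r u v ^ 2 * barTrans θ0 u v = barTrans θ u v / l ^ 2 := fun u v => by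
    have := pos0 u v
    have := pos u v
    simp only [hr]
    rw [div_pow, Real.sq_sqrt (by positivity)]
    field_simp
  have hrow : ∀ u, ∑ v, barTrans θ0 u v * r u v * h v ≤ l * h u := fun u => by
    have e : ∀ v, barTrans θ0 u v * r u v * h v
        = √(barTrans θ u v * barTrans θ0 u v) * h v / l := fun v => by
      have hq := pos0 u v
      have : √(barTrans θ u v * barTrans θ0 u v)
          = barTrans θ0 u v * √(barTrans θ u v / barTrans θ0 u v) := by
        rw [Real.sqrt_eq_iff_mul_self_eq (mul_pos (pos u v) hq).le (by positivity),
          mul_mul_mul_comm, Real.mul_self_sqrt (div_pos (pos u v) hq).le]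
        field_simp
      rw [this]
      simp only [hr]
      ring
    simp only [e]
    rw [← Finset.sum_div, div_le_iff₀ hl0]
    linarith [hh u]
  have bc : ∀ᵐ ω ∂P, ∀ᶠ T in atTop,
      ω ∉ {ω | 1 ≤ ∏ k ∈ Finset.range T, r (ω k) (ω (k + 1))} := by
    refine ae_eventually_notMem (ne_top_of_le_ne_top ?_ (ENNReal.tsum_le_tsum
      (measure_one_le_prod_le hμ0 hPlaw pos0 r0 h1 hl0.le hrow)))
    exact ((summable_geometric_of_lt_one hl0.le hl1).mul_right _).tsum_ofReal_ne_top
  refine ⟨{θ' | ∀ u v, barTrans θ' u v < barTrans θ u v / l ^ 2}, ?_, ?_⟩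
  · refine eventually_all.2 fun u => eventually_all.2 fun v => ?_
    refine (continuous_barTrans u v).continuousAt.eventually_lt_const ?_
    rw [lt_div_iff₀ (by positivity)]
    exact mul_lt_of_lt_one_right (pos u v) (pow_lt_one₀ hl0.le hl1 two_ne_zero)
  · filter_upwards [bc] with ω hω
    filter_upwards [hω] with T hT θ' hθ'
    have pos' := barTrans_pos hbmin hρmin hρmax hθ'.2
    rw [logLik_eq_log_prod pos', logLik_eq_log_prod pos0]
    refine Real.log_lt_log (Finset.prod_pos fun _ _ => pos' _ _) ?_
    have hT' : ∏ k ∈ Finset.range T, r (ω k) (ω (k + 1)) < 1 := not_le.1 hT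
    calc _ ≤ ∏ k ∈ Finset.range T, r (ω k) (ω (k + 1)) ^ 2 * barTrans θ0 (ω k) (ω (k + 1)) :=
          Finset.prod_le_prod (fun _ _ => (pos' _ _).le) fun _ _ => by
            rw [rsq]; exact (hθ'.1 _ _).le
      _ = (∏ k ∈ Finset.range T, r (ω k) (ω (k + 1))) ^ 2 *
          ∏ k ∈ Finset.range T, barTrans θ0 (ω k) (ω (k + 1)) := by
          rw [Finset.prod_mul_distrib, Finset.prod_pow]
      _ < _ := mul_lt_of_lt_one_left (Finset.prod_pos fun _ _ => pos0 _ _)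
          (pow_lt_one₀ (Finset.prod_nonneg fun _ _ => r0 _ _) hT' two_ne_zero)

end Model

/-- **Strong consistency of the ML estimator for the BAR model with positive correlations.**
If `θ0 ∈ Θ`, `μ` is any initial distribution on `{0,1}^p`, and `θhat T ω` is, for each horizon
`T` and trajectory `ω`, a maximizer over `Θ` of the log-likelihood
`θ ↦ ∑_{k=0}^{T−1} log p_{X(k)X(k+1)}(θ)`, then `θhat T → θ0` almost surely under `P_{θ0,μ}`. -/
theorem mle_strong_consistency
    (p : ℕ) (hp : 1 ≤ p) (bmin ρmin ρmax : ℝ)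
    (hbmin : bmin ∈ Set.Ioo (0 : ℝ) 1)
    (hρmin : 0 < ρmin) (hρ : ρmin ≤ ρmax) (hρmax : ρmax < 1)
    (θ0 : Param p) (hθ0 : θ0 ∈ barSpace p bmin ρmin ρmax)
    (μ : State p → ℝ) (hμ0 : ∀ u, 0 ≤ μ u) (hμ1 : ∑ u, μ u = 1)
    (P : Measure (ℕ → State p)) (hPprob : IsProbabilityMeasure P)
    (hPlaw : IsBARLaw θ0 μ P)
    (θhat : ℕ → (ℕ → State p) → Param p)
    (hmem : ∀ T ω, θhat T ω ∈ barSpace p bmin ρmin ρmax)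
    (hmax : ∀ T ω, ∀ θ ∈ barSpace p bmin ρmin ρmax, logLik θ T ω ≤ logLik (θhat T ω) T ω) :
    ∀ᵐ ω ∂P, Tendsto (fun T => θhat T ω) atTop (nhds θ0) := by
  have away : ∀ V : Set (Param p), IsOpen V → θ0 ∈ V →
      ∀ᵐ ω ∂P, ∀ᶠ T in atTop, θhat T ω ∈ V := by
    intro V hV h0
    have hK : IsCompact (barSpace p bmin ρmin ρmax \ V) := (isCompact_barSpace hbmin.1).diff hV
    have key : ∀ᵐ ω ∂P, ∀ᶠ T in atTop,
        ∀ θ ∈ (barSpace p bmin ρmin ρmax \ V) ∩ barSpace p bmin ρmin ρmax,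
          logLik θ T ω < logLik θ0 T ω := by
      refine hK.induction_on (p := fun s => ∀ᵐ ω ∂P, ∀ᶠ T in atTop,
        ∀ θ ∈ s ∩ barSpace p bmin ρmin ρmax, logLik θ T ω < logLik θ0 T ω) ?_ ?_ ?_ ?_
      · simp
      · intro s t hst ht
        filter_upwards [ht] with ω hω
        filter_upwards [hω] with T hT θ hθ using hT θ ⟨hst hθ.1, hθ.2⟩
      · intro s t hs ht
        filter_upwards [hs, ht] with ω hsω htω
        filter_upwards [hsω, htω] with T hsT htT θ hθ
        exact hθ.1.elim (fun h => hsT θ ⟨h, hθ.2⟩) fun h => htT θ ⟨h, hθ.2⟩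
      · intro θ hθ
        obtain ⟨U, hU, hlt⟩ := exists_nhds_logLik_lt hbmin.1 hρmin hρmax hθ0 hμ0 hPlaw hθ.1
          fun he => hθ.2 (he ▸ h0)
        exact ⟨U, nhdsWithin_le_nhds hU, hlt⟩
    filter_upwards [key] with ω hω
    filter_upwards [hω] with T hT
    by_contra hn
    exact (hT _ ⟨⟨hmem T ω, hn⟩, hmem T ω⟩).not_ge (hmax T ω θ0 hθ0)
  have : FirstCountableTopology (Matrix (Fin p) (Fin p) ℝ) :=
    inferInstanceAs (FirstCountableTopology (Fin p → Fin p → ℝ))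
  obtain ⟨B, hB⟩ := (nhds θ0).exists_antitone_basis
  have hall : ∀ᵐ ω ∂P, ∀ n, ∀ᶠ T in atTop, θhat T ω ∈ interior (B n) :=
    ae_all_iff.2 fun n => away _ isOpen_interior (mem_interior_iff_mem_nhds.2 (hB.mem n))
  filter_upwards [hall] with ω hω
  refine hB.tendsto_right_iff.2 fun n _ => ?_
  filter_upwards [hω n] with T hT using interior_subset hT
end

section
/- Identifiability of the BAR model with positive correlations: for any θ = (A, b, ρ_w) and θ' = (A', b', ρ_w') in Θ, if p_{uv}(θ) = p_{uv}(θ') for all pairs of states u, v ∈ {0,1}^p, then A = A', b = b', and ρ_w = ρ_w'. Equivalently, the map from Θ to ℝ^{2^{2p}} sending θ to the vectorized transition probability matrix (p_{uv}(θ))_{u,v} is injective. -/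
open MeasureTheory Filter Matrix

/-- The coordinate marginals of a product of Bernoulli laws on `ι → Bool` are its parameters. -/
theorem sum_ite_prod_bernoulli {ι : Type*} [Fintype ι] [DecidableEq ι] (x : ι → ℝ) (i : ι) :
    ∑ v : ι → Bool, (if v i then ∏ j, (if v j then x j else 1 - x j) else 0) = x i := by
  have key := Finset.prod_univ_sum (fun _ : ι => (Finset.univ : Finset Bool))
    (fun j c => (if c then x j else 1 - x j) * (if j = i then (if c then 1 else 0) else 1))
  rw [Fintype.piFinset_univ] at key
  calc _ = ∑ v : ι → Bool, ∏ j, ((if v j then x j else 1 - x j) *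
          (if j = i then (if v j then 1 else 0) else 1)) := by
        refine Finset.sum_congr rfl fun v _ => ?_
        rw [Finset.prod_mul_distrib, Finset.prod_ite_eq']
        simp
    _ = ∏ j, (if j = i then x j else 1) := by
        rw [← key]
        refine Finset.prod_congr rfl fun j _ => ?_
        by_cases hj : j = i <;> simp [hj]
    _ = x i := by simp

/-- The transition probabilities determine the Bernoulli parameters. -/
theorem bern_eq_of_barTrans_eq {p : ℕ} {θ θ' : Param p}
    (h : ∀ u v : State p, barTrans θ u v = barTrans θ' u v) (u : State p) (i : Fin p) :
    bern θ u i = bern θ' u i := by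
  rw [← sum_ite_prod_bernoulli (bern θ u) i, ← sum_ite_prod_bernoulli (bern θ' u) i]
  refine Finset.sum_congr rfl fun v _ => ?_
  have huv := h u v
  unfold barTrans at huv
  rw [huv]

theorem bern_zero {p : ℕ} (θ : Param p) (i : Fin p) :
    bern θ (fun _ => false) i = θ.2.1 i * θ.2.2 i := by
  simp [bern, stR]

theorem bern_single {p : ℕ} (θ : Param p) (i j : Fin p) :
    bern θ (fun k => decide (k = j)) i = θ.1 i j + θ.2.1 i * θ.2.2 i := by
  simp [bern, stR]

/-- **Identifiability of the BAR model with positive correlations.**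
If two parameter tuples in `Θ` induce the same transition probabilities `p_{uv}`
for all pairs of states, then they are equal: the map `θ ↦ (p_{uv}(θ))_{u,v}`
is injective on `Θ`. -/
theorem bar_identifiability
    (p : ℕ) (hp : 1 ≤ p) (bmin ρmin ρmax : ℝ)
    (hbmin : bmin ∈ Set.Ioo (0 : ℝ) 1)
    (hρmin : 0 < ρmin) (hρ : ρmin ≤ ρmax) (hρmax : ρmax < 1)
    (θ θ' : Param p)
    (hθ : θ ∈ barSpace p bmin ρmin ρmax) (hθ' : θ' ∈ barSpace p bmin ρmin ρmax)
    (h : ∀ u v : State p, barTrans θ u v = barTrans θ' u v) :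
    θ = θ' := by
  have hbern := bern_eq_of_barTrans_eq h
  have hc (i : Fin p) : θ.2.1 i * θ.2.2 i = θ'.2.1 i * θ'.2.2 i := by
    simpa only [bern_zero] using hbern (fun _ => false) i
  have hA (i j : Fin p) : θ.1 i j = θ'.1 i j := by
    have hij := hbern (fun k => decide (k = j)) i
    rw [bern_single, bern_single, hc i] at hij
    exact add_right_cancel hij
  obtain ⟨-, hsum, hb, -⟩ := hθ
  obtain ⟨-, hsum', -, -⟩ := hθ'
  have hbeq (i : Fin p) : θ.2.1 i = θ'.2.1 i := by
    have hrow := (hsum i).trans (hsum' i).symm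
    simp only [hA] at hrow
    exact add_left_cancel hrow
  refine Prod.ext (Matrix.ext hA) (Prod.ext (funext hbeq) (funext fun i => ?_))
  have hpos : θ.2.1 i ≠ 0 := (hbmin.1.trans_le (hb i)).ne'
  have hci := hc i
  rw [← hbeq i] at hci
  exact mul_left_cancel₀ hpos hci
end

section
/- Identifiability of the generic BAR model (Theorem 4): for any θ̃ = (A, Ã, b, ρ_w) and θ̃' = (A', Ã', b', ρ_w') in Θ̃, if p_{uv}(θ̃) = p_{uv}(θ̃') for all pairs of states u, v ∈ {0,1}^p, then A = A', Ã = Ã', b = b', and ρ_w = ρ_w'. Equivalently, the map from Θ̃ to ℝ^{2^{2p}} sending θ̃ to the vectorized transition probability matrix (p_{uv}(θ̃))_{u,v} is injective. -/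
open MeasureTheory Filter Matrix

/-- A parameter tuple `θ̃ = (A, Ã, b, ρ_w)` of the generic BAR model. -/
abbrev GParam (p : ℕ) :=
  Matrix (Fin p) (Fin p) ℝ × Matrix (Fin p) (Fin p) ℝ × (Fin p → ℝ) × (Fin p → ℝ)

/-- The parameter space `Θ̃` of the generic BAR model. -/
def gBarSpace (p : ℕ) (bmin ρmin ρmax : ℝ) : Set (GParam p) :=
  {θ | (∀ i j, 0 ≤ θ.1 i j) ∧ (∀ i j, 0 ≤ θ.2.1 i j) ∧
       (∀ i j, θ.1 i j * θ.2.1 i j = 0) ∧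
       (∀ i, (∑ j, (θ.1 i j + θ.2.1 i j)) + θ.2.2.1 i = 1) ∧
       (∀ i, bmin ≤ θ.2.2.1 i) ∧ (∀ i, θ.2.2.2 i ∈ Set.Icc ρmin ρmax)}

/-- The Bernoulli parameter `a_i^⊤ u + ã_i^⊤ (1_p − u) + b_i ρ_{w_i}` of node `i`
given previous state `u`, for the generic BAR model. -/
noncomputable def gBern {p : ℕ} (θ : GParam p) (u : State p) (i : Fin p) : ℝ :=
  (∑ j, θ.1 i j * stR u j) + (∑ j, θ.2.1 i j * (1 - stR u j)) + θ.2.2.1 i * θ.2.2.2 i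

/-- The generic BAR transition probability `p_{uv}(θ̃)`. -/
noncomputable def gBarTrans {p : ℕ} (θ : GParam p) (u v : State p) : ℝ :=
  ∏ i, if v i then gBern θ u i else 1 - gBern θ u i

/-- The log-likelihood `∑_{k=0}^{T-1} log p_{X(k)X(k+1)}(θ̃)` of a trajectory prefix. -/
noncomputable def gLogLik {p : ℕ} (θ : GParam p) (T : ℕ) (ω : ℕ → State p) : ℝ :=
  ∑ k ∈ Finset.range T, Real.log (gBarTrans θ (ω k) (ω (k + 1)))

/-- `P` is the law of the generic BAR Markov chain with parameter `θ0` and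
initial distribution `μ`. -/
def IsGBARLaw {p : ℕ} (θ0 : GParam p) (μ : State p → ℝ)
    (P : Measure (ℕ → State p)) : Prop :=
  ∀ (n : ℕ) (x : ℕ → State p),
    P {ω | ∀ k ≤ n, ω k = x k} =
      ENNReal.ofReal (μ (x 0) * ∏ k ∈ Finset.range n, gBarTrans θ0 (x k) (x (k + 1)))

/-- The marginals of a product of Bernoulli weights are its parameters. -/
theorem sum_bernoulli_prod_marginal {ι : Type*} [Fintype ι] [DecidableEq ι] (x : ι → ℝ) (i : ι) :
    ∑ v : ι → Bool, (∏ j, if v j then x j else 1 - x j) * (if v i then 1 else 0) = x i := by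
  have key := Fintype.prod_sum (fun (j : ι) (c : Bool) =>
    (if c then x j else 1 - x j) * (if j = i then (if c then 1 else 0) else 1))
  have hl : ∏ j, ∑ c : Bool, (if c then x j else 1 - x j) *
      (if j = i then (if c then 1 else 0) else 1) = x i := by
    rw [Finset.prod_eq_single i]
    · simp
    · intro j _ hj
      simp [hj]
    · simp
  rw [← hl, key]
  refine Finset.sum_congr rfl fun v _ => ?_
  rw [Finset.prod_mul_distrib]
  simp

theorem gBern_eq_of_gBarTrans_eq {p : ℕ} {θ θ' : GParam p} {u : State p}
    (h : ∀ v, gBarTrans θ u v = gBarTrans θ' u v) (i : Fin p) :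
    gBern θ u i = gBern θ' u i := by
  rw [← sum_bernoulli_prod_marginal (gBern θ u) i, ← sum_bernoulli_prod_marginal (gBern θ' u) i]
  exact Finset.sum_congr rfl fun v _ => congrArg (· * _) (h v)

theorem gBern_zero {p : ℕ} (θ : GParam p) (i : Fin p) :
    gBern θ (fun _ => false) i = ∑ j, θ.2.1 i j + θ.2.2.1 i * θ.2.2.2 i := by
  simp [gBern, stR]

theorem gBern_single_sub_gBern_zero {p : ℕ} (θ : GParam p) (i j : Fin p) :
    gBern θ (fun k => decide (k = j)) i - gBern θ (fun _ => false) i =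
      θ.1 i j - θ.2.1 i j := by
  simp [gBern, stR, mul_sub, Finset.sum_sub_distrib]
  ring

/-- The decomposition of a real number into positive and negative parts is unique. -/
theorem eq_and_eq_of_sub_eq_of_mul_eq_zero {a b c d : ℝ} (ha : 0 ≤ a) (hb : 0 ≤ b)
    (hc : 0 ≤ c) (hd : 0 ≤ d) (hab : a * b = 0) (hcd : c * d = 0) (h : a - b = c - d) :
    a = c ∧ b = d := by
  rcases mul_eq_zero.mp hab with h1 | h1 <;> rcases mul_eq_zero.mp hcd with h2 | h2 <;>
    constructor <;> linarith

/-- **Identifiability of the generic BAR model.** If two parameter tuples in `Θ̃`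
induce the same transition probabilities `p_{uv}` for all pairs of states, then they
are equal: the map `θ̃ ↦ (p_{uv}(θ̃))_{u,v}` is injective on `Θ̃`. -/
theorem generic_bar_identifiability
    (p : ℕ) (hp : 1 ≤ p) (bmin ρmin ρmax : ℝ)
    (hbmin : bmin ∈ Set.Ioo (0 : ℝ) 1)
    (hρmin : 0 < ρmin) (hρ : ρmin ≤ ρmax) (hρmax : ρmax < 1)
    (θ θ' : GParam p)
    (hθ : θ ∈ gBarSpace p bmin ρmin ρmax) (hθ' : θ' ∈ gBarSpace p bmin ρmin ρmax)
    (h : ∀ u v : State p, gBarTrans θ u v = gBarTrans θ' u v) :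
    θ = θ' := by
  obtain ⟨A, B, b, r⟩ := θ
  obtain ⟨A', B', b', r'⟩ := θ'
  have hbern u i := gBern_eq_of_gBarTrans_eq (h u) i
  obtain ⟨hA, hB, hAB, hsum, hb, -⟩ := hθ
  obtain ⟨hA', hB', hAB', hsum', -, -⟩ := hθ'
  have hentry i j : A i j = A' i j ∧ B i j = B' i j := by
    refine eq_and_eq_of_sub_eq_of_mul_eq_zero (hA i j) (hB i j) (hA' i j) (hB' i j)
      (hAB i j) (hAB' i j) ?_
    have h1 := gBern_single_sub_gBern_zero (A, B, b, r) i j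
    rw [hbern, hbern, gBern_single_sub_gBern_zero] at h1
    exact h1.symm
  obtain rfl : A = A' := Matrix.ext fun i j => (hentry i j).1
  obtain rfl : B = B' := Matrix.ext fun i j => (hentry i j).2
  obtain rfl : b = b' := funext fun i => add_left_cancel ((hsum i).trans (hsum' i).symm)
  obtain rfl : r = r' := by
    funext i
    have h0 := hbern (fun _ => false) i
    rw [gBern_zero, gBern_zero] at h0
    exact mul_left_cancel₀ (hbmin.1.trans_le (hb i)).ne' (add_left_cancel h0)
  rfl
end

section
/- Strong consistency of the closed-form estimator for the generic BAR model: let θ̃0 = (A, Ã, b, ρ_w) ∈ Θ̃, set Ā = A − Ã and c̄_i = ã_i^⊤ 1_p + b_i ρ_{w_i} for i ∈ [p], and let μ be any initial distribution on {0,1}^p. For a trajectory, horizon T, state u ∈ {0,1}^p and r ∈ [p], let N_u(T) = #{0 ≤ k ≤ T−1 : X(k) = u}, let N_{u,r,1}(T) = #{0 ≤ k ≤ T−1 : X(k) = u, X_r(k+1) = 1}, and let V_T ⊆ {0,1}^p be the set of states visited by time T−1. Define ĉ̄_i(T) = N_{0_p,i,1}(T)/N_{0_p}(T) (when N_{0_p}(T)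 ≥ 1) and, when the matrix ∑_{u∈V_T} u u^⊤ is invertible, define â̄_r(T) = (∑_{u∈V_T} u u^⊤)^{−1} ∑_{u∈V_T} u (N_{u,r,1}(T)/N_u(T) − ĉ̄_r(T)) for r ∈ [p]. Then almost surely under P_{θ̃0,μ}: these estimators are well-defined for all sufficiently large T, ĉ̄(T) → c̄, and â̄_r(T) → ā_r for every r ∈ [p] as T → ∞ (where ā_r^⊤ is the r-th row of Ā). -/
open MeasureTheory Filter Matrix

/-- `N_u(T)`: the number of times `0 ≤ k ≤ T-1` with `X(k) = u`. -/
def Ncnt {p : ℕ} (u : State p) (T : ℕ) (ω : ℕ → State p) : ℕ :=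
  ((Finset.range T).filter fun k => ω k = u).card

/-- `N_{u,r,1}(T)`: the number of `0 ≤ k ≤ T-1` with `X(k) = u` and `X_r(k+1) = 1`. -/
def Nr1 {p : ℕ} (u : State p) (r : Fin p) (T : ℕ) (ω : ℕ → State p) : ℕ :=
  ((Finset.range T).filter fun k => ω k = u ∧ ω (k + 1) r = true).card

/-- The set of states visited by time `T - 1`. -/
def visited {p : ℕ} (T : ℕ) (ω : ℕ → State p) : Finset (State p) :=
  (Finset.range T).image ω

/-- The Gram matrix `∑_{u ∈ V_T} u u^⊤` of the visited states. -/
noncomputable def gram {p : ℕ} (T : ℕ) (ω : ℕ → State p) : Matrix (Fin p) (Fin p) ℝ :=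
  ∑ u ∈ visited T ω, vecMulVec (stR u) (stR u)

/-- The closed-form estimator `c̄̂_i(T) = N_{0_p,i,1}(T) / N_{0_p}(T)` of `c̄_i`. -/
noncomputable def cbarhat {p : ℕ} (i : Fin p) (T : ℕ) (ω : ℕ → State p) : ℝ :=
  (Nr1 (fun _ => false) i T ω : ℝ) / (Ncnt (fun _ => false) T ω : ℝ)

/-- The closed-form estimator
`ā̂_r(T) = (∑_{u∈V_T} u u^⊤)⁻¹ ∑_{u∈V_T} u (N_{u,r,1}(T)/N_u(T) − c̄̂_r(T))` of row `r`
of `Ā = A − Ã`. -/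
noncomputable def abarhat {p : ℕ} (r : Fin p) (T : ℕ) (ω : ℕ → State p) : Fin p → ℝ :=
  (gram T ω)⁻¹ *ᵥ
    ∑ u ∈ visited T ω, (((Nr1 u r T ω : ℝ) / (Ncnt u T ω : ℝ)) - cbarhat r T ω) • stR u

open scoped ENNReal

section FiniteMarkovChain

variable {S : Type*} [Fintype S]

/-- The total weight of all paths with `T` steps grows at most like `c ^ T` when the row sums of
the nonnegative kernel `K` are at most `c`. -/
lemma sum_path_weight_le (K : S → S → ℝ) (hK : ∀ u v, 0 ≤ K u v) (c : ℝ) (hc : 0 ≤ c)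
    (hrow : ∀ u, ∑ v, K u v ≤ c) (T : ℕ) (ν : S → ℝ) (hν : ∀ u, 0 ≤ ν u) :
    ∑ w : Fin (T + 1) → S, ν (w 0) * ∏ k : Fin T, K (w k.castSucc) (w k.succ)
      ≤ (∑ u, ν u) * c ^ T := by
  induction T generalizing ν with
  | zero =>
    rw [← (Equiv.funUnique (Fin 1) S).symm.sum_comp]
    simp [Equiv.funUnique]
  | succ T ih =>
    rw [← (Fin.consEquiv fun _ : Fin (T + 2) => S).sum_comp, Fintype.sum_prod_type,
      Finset.sum_mul]
    refine Finset.sum_le_sum fun u _ => ?_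
    have h := (ih (K u) (hK u)).trans (mul_le_mul_of_nonneg_right (hrow u) (pow_nonneg hc T))
    have h2 := mul_le_mul_of_nonneg_left h (hν u)
    rw [Finset.mul_sum] at h2
    refine le_trans (le_of_eq (Finset.sum_congr rfl fun w _ => ?_)) (h2.trans_eq (by ring))
    simp [Fin.prod_univ_succ, Fin.consEquiv]

/-- One-step bound on the exponential moment of a centered function bounded by one. -/
lemma sum_mul_exp_le (q f : S → ℝ) (hq : ∀ v, 0 ≤ q v) (hq1 : ∑ v, q v = 1)
    (hf : ∀ v, |f v| ≤ 1) (hmean : ∑ v, q v * f v = 0) (l : ℝ) (hl : |l| ≤ 1) :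
    ∑ v, q v * Real.exp (l * f v) ≤ Real.exp (l ^ 2) := by
  have key : ∀ v, q v * Real.exp (l * f v) ≤ q v + l * (q v * f v) + l ^ 2 * q v := by
    intro v
    have h1 : |l * f v| ≤ 1 := by
      rw [abs_mul]
      exact mul_le_one₀ hl (abs_nonneg _) (hf v)
    have h2 := (abs_le.1 (Real.abs_exp_sub_one_sub_id_le h1)).2
    have h3 : (l * f v) ^ 2 ≤ l ^ 2 := by
      rw [mul_pow]
      exact mul_le_of_le_one_right (sq_nonneg l) ((sq_le_one_iff_abs_le_one _).2 (hf v))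
    have h4 : Real.exp (l * f v) ≤ 1 + l * f v + l ^ 2 := by linarith
    nlinarith [mul_le_mul_of_nonneg_left h4 (hq v)]
  refine (Finset.sum_le_sum fun v _ => key v).trans ?_
  rw [Finset.sum_add_distrib, Finset.sum_add_distrib, ← Finset.mul_sum, ← Finset.mul_sum, hq1,
    hmean]
  linarith [Real.add_one_le_exp (l ^ 2)]

variable (K : S → S → ℝ) (μ : S → ℝ) [MeasurableSpace (ℕ → S)] (P : Measure (ℕ → S))

/-- Chernoff bound for additive functionals of a finite Markov chain with centered increments. -/
lemma measure_additive_functional_ge_le (hK : ∀ u v, 0 ≤ K u v) (hrow : ∀ u, ∑ v, K u v = 1)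
    (hμ : ∀ u, 0 ≤ μ u) (hμ1 : ∑ u, μ u = 1)
    (hP : ∀ (n : ℕ) (x : ℕ → S), P {ω | ∀ k ≤ n, ω k = x k} =
      ENNReal.ofReal (μ (x 0) * ∏ k ∈ Finset.range n, K (x k) (x (k + 1))))
    (f : S → S → ℝ) (hf : ∀ u v, |f u v| ≤ 1) (hmean : ∀ u, ∑ v, K u v * f u v = 0)
    (l : ℝ) (hl0 : 0 ≤ l) (hl1 : l ≤ 1) (ε : ℝ) (T : ℕ) :
    P {ω | ε * T ≤ ∑ k ∈ Finset.range T, f (ω k) (ω (k + 1))} ≤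
      ENNReal.ofReal (Real.exp (l ^ 2 - l * ε) ^ T) := by
  classical
  let F : (Fin (T + 1) → S) → ℝ := fun w => ∑ k : Fin T, f (w k.castSucc) (w k.succ)
  let W : (Fin (T + 1) → S) → ℝ := fun w => μ (w 0) * ∏ k : Fin T, K (w k.castSucc) (w k.succ)
  have hW : ∀ w, 0 ≤ W w := fun w => mul_nonneg (hμ _) (Finset.prod_nonneg fun _ _ => hK _ _)
  let C : (Fin (T + 1) → S) → Set (ℕ → S) := fun w => {ω | ∀ k : Fin (T + 1), ω k = w k}
  have hC : ∀ w, P (C w) = ENNReal.ofReal (W w) := by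
    intro w
    let x : ℕ → S := fun k => if h : k < T + 1 then w ⟨k, h⟩ else w 0
    have hx : ∀ k : Fin (T + 1), x k = w k := fun k => dif_pos k.2
    have hset : C w = {ω | ∀ k ≤ T, ω k = x k} := by
      ext ω
      constructor
      · intro h k hk
        have := h ⟨k, Nat.lt_succ_of_le hk⟩
        rw [← hx] at this
        exact this
      · intro h k
        rw [h k (Nat.le_of_lt_succ k.2), hx]
    rw [hset, hP, Finset.prod_range]
    congr 2
    refine Finset.prod_congr rfl fun k _ => ?_
    rw [← hx, ← hx]
    simp
  have hsub : {ω : ℕ → S | ε * T ≤ ∑ k ∈ Finset.range T, f (ω k) (ω (k + 1))} ⊆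
      ⋃ w ∈ Finset.univ.filter (fun w => ε * T ≤ F w), C w := by
    intro ω hω
    simp only [Set.mem_iUnion]
    refine ⟨fun k => ω k, ?_, fun k => rfl⟩
    rw [Finset.mem_filter]
    refine ⟨Finset.mem_univ _, ?_⟩
    rw [Set.mem_ofPred_eq, Finset.sum_range] at hω
    simpa [F] using hω
  refine (measure_mono hsub).trans ((measure_biUnion_finset_le _ _).trans ?_)
  simp_rw [hC]
  rw [← ENNReal.ofReal_sum_of_nonneg fun w _ => hW w]
  refine ENNReal.ofReal_le_ofReal ?_
  have hexp : ∀ w, W w * Real.exp (l * F w) =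
      μ (w 0) * ∏ k : Fin T, (K (w k.castSucc) (w k.succ) *
        Real.exp (l * f (w k.castSucc) (w k.succ))) := by
    intro w
    simp only [W, F]
    rw [Finset.prod_mul_distrib, Finset.mul_sum, Real.exp_sum, mul_assoc]
  have htot : ∑ w, W w * Real.exp (l * F w) ≤ Real.exp (l ^ 2) ^ T := by
    simp_rw [hexp]
    refine (sum_path_weight_le (fun u v => K u v * Real.exp (l * f u v))
      (fun u v => mul_nonneg (hK u v) (Real.exp_pos _).le) (Real.exp (l ^ 2)) (Real.exp_pos _).le
      (fun u => sum_mul_exp_le (K u) (f u) (hK u) (hrow u) (hf u) (hmean u) l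
        (abs_le.2 ⟨by linarith, hl1⟩)) T μ hμ).trans ?_
    rw [hμ1, one_mul]
  calc ∑ w with ε * T ≤ F w, W w
      ≤ ∑ w with ε * T ≤ F w, W w * Real.exp (l * F w) * Real.exp (-(l * ε * T)) := by
        refine Finset.sum_le_sum fun w hw => ?_
        rw [mul_assoc, ← Real.exp_add]
        refine le_mul_of_one_le_right (hW w) (Real.one_le_exp ?_)
        nlinarith [mul_le_mul_of_nonneg_left (Finset.mem_filter.1 hw).2 hl0]
    _ ≤ ∑ w, W w * Real.exp (l * F w) * Real.exp (-(l * ε * T)) :=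
        Finset.sum_le_sum_of_subset_of_nonneg (Finset.filter_subset _ _) fun w _ _ => by
          have := hW w
          positivity
    _ ≤ Real.exp (l ^ 2) ^ T * Real.exp (-(l * ε * T)) := by
        rw [← Finset.sum_mul]
        exact mul_le_mul_of_nonneg_right htot (Real.exp_pos _).le
    _ = Real.exp (l ^ 2 - l * ε) ^ T := by
        rw [← Real.exp_nat_mul, ← Real.exp_nat_mul, ← Real.exp_add]
        congr 1
        ring

/-- Almost surely, an additive functional with centered increments eventually stays below
`ε * T`. -/
lemma ae_eventually_additive_functional_lt (hK : ∀ u v, 0 ≤ K u v)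
    (hrow : ∀ u, ∑ v, K u v = 1) (hμ : ∀ u, 0 ≤ μ u) (hμ1 : ∑ u, μ u = 1)
    (hP : ∀ (n : ℕ) (x : ℕ → S), P {ω | ∀ k ≤ n, ω k = x k} =
      ENNReal.ofReal (μ (x 0) * ∏ k ∈ Finset.range n, K (x k) (x (k + 1))))
    (f : S → S → ℝ) (hf : ∀ u v, |f u v| ≤ 1) (hmean : ∀ u, ∑ v, K u v * f u v = 0)
    (ε : ℝ) (hε : 0 < ε) (hε1 : ε ≤ 1) :
    ∀ᵐ ω ∂P, ∀ᶠ T : ℕ in atTop, ∑ k ∈ Finset.range T, f (ω k) (ω (k + 1)) < ε * T := by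
  have hb := measure_additive_functional_ge_le K μ P hK hrow hμ hμ1 hP f hf hmean (ε / 2)
    (by linarith) (by linarith) ε
  have hlt : Real.exp ((ε / 2) ^ 2 - ε / 2 * ε) < 1 := by
    rw [Real.exp_lt_one_iff]
    nlinarith
  have hsum : ∑' T : ℕ, P {ω | ε * T ≤ ∑ k ∈ Finset.range T, f (ω k) (ω (k + 1))} ≠ ∞ :=
    ne_top_of_le_ne_top (summable_geometric_of_lt_one (Real.exp_pos _).le hlt).tsum_ofReal_ne_top
      (ENNReal.tsum_le_tsum hb)
  filter_upwards [ae_eventually_notMem hsum] with ω hω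
  filter_upwards [hω] with T hT
  exact not_le.1 hT

/-- Strong law of large numbers for additive functionals of a finite Markov chain with centered
increments bounded by one. -/
lemma ae_tendsto_additive_functional_div (hK : ∀ u v, 0 ≤ K u v)
    (hrow : ∀ u, ∑ v, K u v = 1) (hμ : ∀ u, 0 ≤ μ u) (hμ1 : ∑ u, μ u = 1)
    (hP : ∀ (n : ℕ) (x : ℕ → S), P {ω | ∀ k ≤ n, ω k = x k} =
      ENNReal.ofReal (μ (x 0) * ∏ k ∈ Finset.range n, K (x k) (x (k + 1))))
    (f : S → S → ℝ) (hf : ∀ u v, |f u v| ≤ 1) (hmean : ∀ u, ∑ v, K u v * f u v = 0) :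
    ∀ᵐ ω ∂P, Tendsto (fun T : ℕ => (∑ k ∈ Finset.range T, f (ω k) (ω (k + 1))) / T) atTop
      (nhds 0) := by
  have hpos : ∀ n : ℕ, (0 : ℝ) < 1 / (n + 1) := fun n => Nat.one_div_pos_of_nat
  have hle : ∀ n : ℕ, (1 : ℝ) / (n + 1) ≤ 1 := fun n =>
    (div_le_one (by positivity)).2 (by linarith [n.cast_nonneg (α := ℝ)])
  have h1 := ae_all_iff.2 fun n : ℕ => ae_eventually_additive_functional_lt K μ P hK hrow hμ hμ1
    hP f hf hmean (1 / (n + 1)) (hpos n) (hle n)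
  have h2 := ae_all_iff.2 fun n : ℕ => ae_eventually_additive_functional_lt K μ P hK hrow hμ hμ1
    hP (fun u v => -f u v) (fun u v => by rw [abs_neg]; exact hf u v)
    (fun u => by simp [hmean]) (1 / (n + 1)) (hpos n) (hle n)
  filter_upwards [h1, h2] with ω hω1 hω2
  rw [Metric.tendsto_atTop']
  intro ε hε
  obtain ⟨n, hn⟩ := exists_nat_one_div_lt hε
  obtain ⟨N, hN⟩ := eventually_atTop.1 ((hω1 n).and (hω2 n))
  refine ⟨N, fun T hT => ?_⟩
  obtain ⟨ha, hb⟩ := hN T hT.le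
  have hT0 : (0 : ℝ) < T := Nat.cast_pos.2 (Nat.zero_lt_of_lt hT)
  rw [Finset.sum_neg_distrib] at hb
  rw [Real.dist_eq, sub_zero, abs_div, abs_of_pos hT0, div_lt_iff₀ hT0, abs_lt]
  have := mul_lt_mul_of_pos_right hn hT0
  constructor <;> linarith

end FiniteMarkovChain

section BAR

variable {p : ℕ}

lemma stR_mem_Icc (u : State p) (i : Fin p) : stR u i ∈ Set.Icc (0 : ℝ) 1 := by
  unfold stR
  split_ifs <;> simp

lemma gBern_mem_Ioo {bmin ρmin ρmax : ℝ} (hbmin : 0 < bmin) (hρmin : 0 < ρmin)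
    (hρmax : ρmax < 1) {θ : GParam p} (hθ : θ ∈ gBarSpace p bmin ρmin ρmax) (u : State p)
    (i : Fin p) : gBern θ u i ∈ Set.Ioo (0 : ℝ) 1 := by
  obtain ⟨hA, hB, -, hsum, hb, hρ⟩ := hθ
  have hbi : 0 < θ.2.2.1 i := hbmin.trans_le (hb i)
  have hρ0 : 0 < θ.2.2.2 i := hρmin.trans_le (hρ i).1
  have hρ1 : θ.2.2.2 i < 1 := (hρ i).2.trans_lt hρmax
  have h1 : 0 ≤ ∑ j, θ.1 i j * stR u j :=
    Finset.sum_nonneg fun j _ => mul_nonneg (hA i j) (stR_mem_Icc u j).1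
  have h2 : 0 ≤ ∑ j, θ.2.1 i j * (1 - stR u j) :=
    Finset.sum_nonneg fun j _ => mul_nonneg (hB i j) (sub_nonneg.2 (stR_mem_Icc u j).2)
  have h3 : ∑ j, θ.1 i j * stR u j + ∑ j, θ.2.1 i j * (1 - stR u j) ≤
      ∑ j, (θ.1 i j + θ.2.1 i j) := by
    rw [← Finset.sum_add_distrib]
    refine Finset.sum_le_sum fun j _ => add_le_add
      (mul_le_of_le_one_right (hA i j) (stR_mem_Icc u j).2)
      (mul_le_of_le_one_right (hB i j) (by linarith [(stR_mem_Icc u j).1]))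
  have h4 := hsum i
  unfold gBern
  constructor
  · have := mul_pos hbi hρ0
    linarith
  · have := mul_lt_mul_of_pos_left hρ1 hbi
    linarith

lemma gBarTrans_pos {θ : GParam p} {u : State p} (h : ∀ i, gBern θ u i ∈ Set.Ioo (0 : ℝ) 1)
    (v : State p) : 0 < gBarTrans θ u v := by
  refine Finset.prod_pos fun i _ => ?_
  split_ifs
  · exact (h i).1
  · exact sub_pos.2 (h i).2

lemma sum_gBarTrans_mul_prod (θ : GParam p) (u : State p) (g : Fin p → Bool → ℝ) :
    ∑ v, gBarTrans θ u v * ∏ i, g i (v i) =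
      ∏ i, (gBern θ u i * g i true + (1 - gBern θ u i) * g i false) := by
  have h := Finset.prod_univ_sum (fun _ : Fin p => (Finset.univ : Finset Bool))
    (fun i b => (if b then gBern θ u i else 1 - gBern θ u i) * g i b)
  rw [Fintype.piFinset_univ] at h
  simp only [Fintype.sum_bool, if_true, Bool.false_eq_true, if_false] at h
  rw [h]
  simp only [gBarTrans, Finset.prod_mul_distrib]

lemma sum_gBarTrans (θ : GParam p) (u : State p) : ∑ v, gBarTrans θ u v = 1 := by
  simpa using sum_gBarTrans_mul_prod θ u fun _ _ => 1

lemma sum_gBarTrans_mul_stR (θ : GParam p) (u : State p) (r : Fin p) :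
    ∑ v, gBarTrans θ u v * stR v r = gBern θ u r := by
  have h := sum_gBarTrans_mul_prod θ u fun i b => if i = r then (if b then 1 else 0) else 1
  have h1 : ∀ v : State p, ∏ i, (if i = r then (if v i then 1 else 0) else 1 : ℝ) = stR v r := by
    intro v
    rw [Finset.prod_ite_eq' Finset.univ r fun i => (if v i then 1 else 0 : ℝ)]
    simp [stR]
  simp_rw [h1] at h
  rw [h, Finset.prod_eq_single r]
  · simp
  · intro i _ hi
    simp [hi]
  · simp

/-- The visit counts grow linearly. -/
lemma exists_pos_eventually_mul_le_Ncnt {θ : GParam p}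
    (hB : ∀ u i, gBern θ u i ∈ Set.Ioo (0 : ℝ) 1) (u : State p) {ω : ℕ → State p}
    (hω : Tendsto (fun T : ℕ => (∑ k ∈ Finset.range T,
      ((if ω (k + 1) = u then 1 else 0) - gBarTrans θ (ω k) u)) / T) atTop (nhds 0)) :
    ∃ δ : ℝ, 0 < δ ∧ ∀ᶠ T : ℕ in atTop, δ * T ≤ Ncnt u T ω := by
  obtain ⟨s, hs⟩ := Finite.exists_min fun s => gBarTrans θ s u
  have hd : 0 < gBarTrans θ s u := gBarTrans_pos (hB s) u
  set d := gBarTrans θ s u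
  refine ⟨d / 4, by linarith, ?_⟩
  have hev : ∀ᶠ T : ℕ in atTop, d / 4 * (T + 1 : ℕ) ≤ Ncnt u (T + 1) ω := by
    filter_upwards [hω.eventually (lt_mem_nhds (show -(d / 2) < 0 by linarith)),
      eventually_ge_atTop 1] with T hT hT1
    have hT1' : (1 : ℝ) ≤ T := by exact_mod_cast hT1
    rw [lt_div_iff₀ (by linarith), Finset.sum_sub_distrib] at hT
    have hlow : d * T ≤ ∑ k ∈ Finset.range T, gBarTrans θ (ω k) u := by
      have := Finset.card_nsmul_le_sum (Finset.range T) (fun k => gBarTrans θ (ω k) u) d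
        fun k _ => hs (ω k)
      rw [Finset.card_range, nsmul_eq_mul] at this
      linarith
    have hN : ∑ k ∈ Finset.range T, (if ω (k + 1) = u then 1 else 0 : ℝ) ≤ Ncnt u (T + 1) ω := by
      rw [Ncnt, Finset.card_filter, Finset.sum_range_succ']
      push_cast
      split_ifs <;> simp
    push_cast
    nlinarith
  exact (eventually_atTop.1 hev).elim fun N hN => eventually_atTop.2 ⟨N + 1, fun T hT => by
    obtain ⟨m, rfl⟩ := Nat.exists_eq_add_of_le' (show 1 ≤ T by omega)
    exact hN m (by omega)⟩

lemma tendsto_Nr1_div_Ncnt (q : ℝ) (u : State p) (r : Fin p) {ω : ℕ → State p} {δ : ℝ}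
    (hδ : 0 < δ) (hN : ∀ᶠ T : ℕ in atTop, δ * T ≤ Ncnt u T ω)
    (hω : Tendsto (fun T : ℕ => (∑ k ∈ Finset.range T,
      (if ω k = u then stR (ω (k + 1)) r - q else 0)) / T) atTop (nhds 0)) :
    Tendsto (fun T => (Nr1 u r T ω : ℝ) / (Ncnt u T ω : ℝ)) atTop (nhds q) := by
  have hsum : ∀ T, ∑ k ∈ Finset.range T, (if ω k = u then stR (ω (k + 1)) r - q else 0) =
      (Nr1 u r T ω : ℝ) - q * Ncnt u T ω := by
    intro T
    rw [Nr1, Ncnt, Finset.card_filter, Finset.card_filter]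
    push_cast
    rw [Finset.mul_sum, ← Finset.sum_sub_distrib]
    refine Finset.sum_congr rfl fun k _ => ?_
    by_cases h : ω k = u <;> simp [h, stR]
  simp_rw [hsum] at hω
  rw [tendsto_iff_norm_sub_tendsto_zero]
  have hlim := (hω.norm).mul_const δ⁻¹
  rw [norm_zero, zero_mul] at hlim
  refine squeeze_zero' (Eventually.of_forall fun _ => norm_nonneg _) ?_ hlim
  filter_upwards [hN, eventually_ge_atTop 1] with T hT hT1
  have hT0 : (0 : ℝ) < T := by exact_mod_cast hT1
  have hN0 : (0 : ℝ) < Ncnt u T ω := (mul_pos hδ hT0).trans_le hT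
  have heq : (Nr1 u r T ω : ℝ) / Ncnt u T ω - q =
      ((Nr1 u r T ω : ℝ) - q * Ncnt u T ω) / Ncnt u T ω := by
    field_simp
  rw [heq, norm_div, norm_div, Real.norm_of_nonneg hN0.le, Real.norm_of_nonneg hT0.le,
    div_mul_eq_mul_div, ← div_eq_mul_inv, div_div]
  exact div_le_div_of_nonneg_left (norm_nonneg _) (mul_pos hδ hT0) hT

/-- The Gram matrix of all states is invertible. -/
lemma isUnit_sum_vecMulVec_stR :
    IsUnit (∑ u : State p, vecMulVec (stR u) (stR u)) := by
  rw [← mulVec_injective_iff_isUnit]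
  intro x y hxy
  have hz : (∑ u : State p, vecMulVec (stR u) (stR u)) *ᵥ (x - y) = 0 := by
    rw [mulVec_sub, sub_eq_zero]
    exact hxy
  have hquad : ∑ u : State p, (stR u ⬝ᵥ (x - y)) ^ 2 = 0 := by
    have h := congrArg (fun z => (x - y) ⬝ᵥ z) hz
    simp only [sum_mulVec, dotProduct_zero, dotProduct_sum, vecMulVec_mulVec] at h
    rw [← h]
    refine Finset.sum_congr rfl fun u _ => ?_
    simp [dotProduct_comm (x - y), sq, sub_mul]
  funext i
  have hi := (Finset.sum_eq_zero_iff_of_nonneg fun u _ => sq_nonneg _).1 hquad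
    (fun j => decide (j = i)) (Finset.mem_univ _)
  simpa [stR, dotProduct, sub_eq_zero] using hi

lemma gBern_sub_gBern_zero (θ : GParam p) (u : State p) (r : Fin p) :
    gBern θ u r - gBern θ (fun _ => false) r = stR u ⬝ᵥ fun j => θ.1 r j - θ.2.1 r j := by
  simp only [gBern, stR, dotProduct, Bool.false_eq_true, if_false, mul_zero, sub_zero, mul_one,
    Finset.sum_const_zero, zero_add]
  rw [add_sub_add_right_eq_sub, ← Finset.sum_add_distrib, ← Finset.sum_sub_distrib]
  refine Finset.sum_congr rfl fun j _ => ?_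
  ring

lemma eventually_visited_eq_univ {ω : ℕ → State p}
    (h : ∀ u, ∀ᶠ T : ℕ in atTop, 1 ≤ Ncnt u T ω) :
    ∀ᶠ T : ℕ in atTop, visited T ω = Finset.univ := by
  filter_upwards [eventually_all.2 h] with T hT
  refine Finset.eq_univ_of_forall fun u => ?_
  obtain ⟨k, hk⟩ := Finset.card_pos.1 (hT u)
  rw [Finset.mem_filter] at hk
  exact Finset.mem_image.2 ⟨k, hk.1, hk.2⟩

/-- Consistency of the estimators along a trajectory on which every state is visited infinitely
often and the empirical conditional frequencies converge. -/
lemma tendsto_abarhat {θ : GParam p} {ω : ℕ → State p}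
    (hV : ∀ᶠ T : ℕ in atTop, visited T ω = Finset.univ)
    (hq : ∀ u r, Tendsto (fun T => (Nr1 u r T ω : ℝ) / (Ncnt u T ω : ℝ)) atTop
      (nhds (gBern θ u r))) (r : Fin p) :
    Tendsto (fun T => abarhat r T ω) atTop (nhds fun j => θ.1 r j - θ.2.1 r j) := by
  set G : Matrix (Fin p) (Fin p) ℝ := ∑ u : State p, vecMulVec (stR u) (stR u) with hG
  have hlim : Tendsto (fun T => G⁻¹ *ᵥ ∑ u : State p,
      (((Nr1 u r T ω : ℝ) / (Ncnt u T ω : ℝ)) - cbarhat r T ω) • stR u) atTop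
      (nhds (G⁻¹ *ᵥ ∑ u : State p,
        (gBern θ u r - gBern θ (fun _ => false) r) • stR u)) :=
    ((continuous_const.matrix_mulVec continuous_id).tendsto _).comp
      (tendsto_finsetSum _ fun u _ => ((hq u r).sub (hq _ r)).smul_const (stR u))
  have hval : G⁻¹ *ᵥ ∑ u : State p, (gBern θ u r - gBern θ (fun _ => false) r) • stR u =
      fun j => θ.1 r j - θ.2.1 r j := by
    have hGa : ∑ u : State p, (gBern θ u r - gBern θ (fun _ => false) r) • stR u =
        G *ᵥ fun j => θ.1 r j - θ.2.1 r j := by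
      rw [hG, sum_mulVec]
      refine Finset.sum_congr rfl fun u _ => ?_
      rw [gBern_sub_gBern_zero, vecMulVec_mulVec]
      simp
    rw [hGa, mulVec_mulVec, nonsing_inv_mul _ ((isUnit_iff_isUnit_det _).1
      isUnit_sum_vecMulVec_stR), one_mulVec]
  rw [hval] at hlim
  refine hlim.congr' ?_
  filter_upwards [hV] with T hT
  rw [abarhat, _root_.gram, hT]

end BAR

/-- **Strong consistency of the closed-form estimator for the generic BAR model.**
With `Ā = A − Ã` and `c̄_i = ã_i^⊤ 1_p + b_i ρ_{w_i}`, almost surely under `P_{θ̃0,μ}`: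
the estimators are well-defined for all sufficiently large `T` (the zero state has been
visited and the Gram matrix of visited states is invertible), `c̄̂(T) → c̄`, and
`ā̂_r(T) → ā_r` (the `r`-th row of `Ā`) for every `r`. -/
theorem generic_closed_form_strong_consistency
    (p : ℕ) (hp : 1 ≤ p) (bmin ρmin ρmax : ℝ)
    (hbmin : bmin ∈ Set.Ioo (0 : ℝ) 1)
    (hρmin : 0 < ρmin) (hρ : ρmin ≤ ρmax) (hρmax : ρmax < 1)
    (θ0 : GParam p) (hθ0 : θ0 ∈ gBarSpace p bmin ρmin ρmax)
    (μ : State p → ℝ) (hμ0 : ∀ u, 0 ≤ μ u) (hμ1 : ∑ u, μ u = 1)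
    (P : Measure (ℕ → State p)) (hPprob : IsProbabilityMeasure P)
    (hPlaw : IsGBARLaw θ0 μ P) :
    ∀ᵐ ω ∂P,
      (∃ T0, ∀ T ≥ T0, 1 ≤ Ncnt (fun _ => false) T ω ∧ IsUnit (gram T ω)) ∧
      Tendsto (fun T => fun i => cbarhat i T ω) atTop
        (nhds (fun i => (∑ j, θ0.2.1 i j) + θ0.2.2.1 i * θ0.2.2.2 i)) ∧
      ∀ r : Fin p, Tendsto (fun T => abarhat r T ω) atTop
        (nhds (fun j => θ0.1 r j - θ0.2.1 r j)) := by
  have hB := gBern_mem_Ioo hbmin.1 hρmin hρmax hθ0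
  have hpos : ∀ u v, 0 < gBarTrans θ0 u v := fun u => gBarTrans_pos (hB u)
  have hlaw := ae_tendsto_additive_functional_div (gBarTrans θ0) μ P (fun u v => (hpos u v).le)
    (sum_gBarTrans θ0) hμ0 hμ1 hPlaw
  have hvisit := ae_all_iff.2 fun u : State p =>
    hlaw (fun s v => (if v = u then 1 else 0) - gBarTrans θ0 s u)
    (fun s v => by
      have h1 : gBarTrans θ0 s u ≤ 1 := by
        rw [← sum_gBarTrans θ0 s]
        exact Finset.single_le_sum (fun v _ => (hpos s v).le) (Finset.mem_univ u)
      have h0 := hpos s u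
      rw [abs_le]
      split_ifs <;> constructor <;> linarith)
    (fun s => by simp [mul_sub, ← Finset.sum_mul, sum_gBarTrans])
  have hfreq := ae_all_iff.2 fun u : State p => ae_all_iff.2 fun r : Fin p =>
    hlaw (fun s v => if s = u then stR v r - gBern θ0 u r else 0)
    (fun s v => by
      have h1 := hB u r
      have h2 := stR_mem_Icc v r
      rw [abs_le]
      split_ifs <;> constructor <;> linarith [h1.1, h1.2, h2.1, h2.2])
    (fun s => by
      by_cases h : s = u
      · subst h
        simp [mul_sub, ← Finset.sum_mul, sum_gBarTrans, sum_gBarTrans_mul_stR]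
      · simp [h])
  filter_upwards [hvisit, hfreq] with ω hω1 hω2
  choose δ hδ hN using fun u => exists_pos_eventually_mul_le_Ncnt hB u (hω1 u)
  have hN1 : ∀ u, ∀ᶠ T : ℕ in atTop, 1 ≤ Ncnt u T ω := by
    intro u
    filter_upwards [hN u, eventually_ge_atTop 1] with T hT hT1
    have hT0 : (0 : ℝ) < T := by exact_mod_cast hT1
    exact_mod_cast (mul_pos (hδ u) hT0).trans_le hT
  have hV := eventually_visited_eq_univ hN1
  have hq := fun u r => tendsto_Nr1_div_Ncnt _ u r (hδ u) (hN u) (hω2 u r)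
  refine ⟨eventually_atTop.1 ?_, tendsto_pi_nhds.2 fun i => ?_, tendsto_abarhat hV hq⟩
  · filter_upwards [hN1 fun _ => false, hV] with T hT hVT
    refine ⟨hT, ?_⟩
    rw [_root_.gram, hVT]
    exact isUnit_sum_vecMulVec_stR
  · simpa [gBern, stR, cbarhat] using hq (fun _ => false) i
end
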